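/- The sequence 0 → R → R_f ⊕ R̂ → R̂_f → 0 is exact, where the first map sends r to (r/1, ι(r)), and the second map sends (a, b) to the difference of the images of a and b in R̂_f (via the canonical maps R_f → R̂_f and R̂ → R̂_f). That is: the first map is injective, its image equals the kernel of the second map, and the second map is surjective. -/

import Mathlib

noncomputable section

variable (R : Type*) [CommRing R] (f : R)

/-- The `(f)`-adic completion `R̂` of `R`. -/
abbrev Rhat : Type _ := AdicCompletion (Ideal.span {f}) R

/-- The localization `R_f = R[f⁻¹]`. -/
abbrev Rf : Type _ := Localization.Away f

/-- The localization `R̂_f = R̂[ι(f)⁻¹]`. -/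
abbrev Rhatf : Type _ := Localization.Away (algebraMap R (Rhat R f) f)

/-- The canonical ring map `R_f → R̂_f` extending `ι : R → R̂`. -/
noncomputable def psi : Rf R f →+* Rhatf R f :=
  Localization.awayMap (algebraMap R (Rhat R f)) f

variable {R f}

theorem evalₐ_span_singleton_algebraMap_eq_zero_iff (n : ℕ) (r : R) :
    AdicCompletion.evalₐ (Ideal.span {f}) n (algebraMap R (Rhat R f) r) = 0 ↔ f ^ n ∣ r := by
  rw [AlgHom.commutes, Ideal.Quotient.algebraMap_eq, Ideal.Quotient.eq_zero_iff_mem,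
    Ideal.span_singleton_pow, Ideal.mem_span_singleton]

theorem pow_dvd_of_algebraMap_eq_mul {n : ℕ} {r : R} {y : Rhat R f}
    (h : algebraMap R (Rhat R f) r = algebraMap R (Rhat R f) f ^ n * y) : f ^ n ∣ r := by
  rw [← evalₐ_span_singleton_algebraMap_eq_zero_iff, h, map_mul, ← map_pow,
    (evalₐ_span_singleton_algebraMap_eq_zero_iff n (f ^ n)).2 dvd_rfl, zero_mul]

theorem exists_eq_algebraMap_add_pow_mul (n : ℕ) (x : Rhat R f) :
    ∃ (r : R) (y : Rhat R f),
      x = algebraMap R (Rhat R f) r + algebraMap R (Rhat R f) f ^ n * y := by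
  obtain ⟨r, hr⟩ := Submodule.mkQ_surjective _ (AdicCompletion.eval (Ideal.span {f}) R n x)
  have hx : x - algebraMap R (Rhat R f) r ∈
      (AdicCompletion.eval (Ideal.span {f}) R n).ker := by
    rw [LinearMap.mem_ker, map_sub, ← hr]
    exact sub_self _
  rw [← AdicCompletion.pow_smul_top_eq_ker_eval (Submodule.fg_span_singleton f),
    Ideal.span_singleton_pow, Submodule.ideal_span_singleton_smul,
    Submodule.mem_smul_pointwise_iff_exists] at hx
  obtain ⟨y, -, hy⟩ := hx
  refine ⟨r, y, ?_⟩
  rw [← map_pow, ← Algebra.smul_def, hy, add_sub_cancel]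

theorem algebraMap_mem_nonZeroDivisors (hf : f ∈ nonZeroDivisors R) :
    algebraMap R (Rhat R f) f ∈ nonZeroDivisors (Rhat R f) := by
  rw [mem_nonZeroDivisors_iff_right]
  intro x hx
  refine AdicCompletion.ext_evalₐ fun n => ?_
  obtain ⟨r, y, rfl⟩ := exists_eq_algebraMap_add_pow_mul (n + 1) x
  have h : f ^ (n + 1) ∣ r * f := by
    refine pow_dvd_of_algebraMap_eq_mul (y := -(y * algebraMap R (Rhat R f) f)) ?_
    rw [map_mul]
    linear_combination hx
  have hr : f ^ n ∣ r := by
    obtain ⟨s, hs⟩ := h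
    refine ⟨s, (mul_cancel_right_mem_nonZeroDivisors hf).1 ?_⟩
    linear_combination hs
  rw [map_add, map_mul, ← map_pow, map_zero,
    (evalₐ_span_singleton_algebraMap_eq_zero_iff n r).2 hr,
    (evalₐ_span_singleton_algebraMap_eq_zero_iff n (f ^ (n + 1))).2 (pow_dvd_pow f n.le_succ),
    zero_mul, add_zero]

theorem psi_algebraMap (r : R) :
    psi R f (algebraMap R (Rf R f) r) =
      algebraMap (Rhat R f) (Rhatf R f) (algebraMap R (Rhat R f) r) :=
  IsLocalization.map_eq (M := Submonoid.powers f)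
    (T := Submonoid.powers (algebraMap R (Rhat R f) f))
    (Submonoid.powers_le.2 (Submonoid.mem_powers (algebraMap R (Rhat R f) f))) r

variable (R f)

/-- the sequence `0 → R → R_f ⊕ R̂ → R̂_f → 0` is exact. -/
theorem stmt0 [IsNoetherianRing R] (hf : f ∈ nonZeroDivisors R) :
    Function.Injective
      (fun r : R => ((algebraMap R (Rf R f)) r, (algebraMap R (Rhat R f)) r)) ∧
    (∀ (a : Rf R f) (b : Rhat R f),
      psi R f a - algebraMap (Rhat R f) (Rhatf R f) b = 0 ↔
        ∃ r : R, a = algebraMap R (Rf R f) r ∧ b = algebraMap R (Rhat R f) r) ∧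
    Function.Surjective
      (fun p : Rf R f × Rhat R f =>
        psi R f p.1 - algebraMap (Rhat R f) (Rhatf R f) p.2) := by
  have hφ : Function.Injective (algebraMap R (Rf R f)) :=
    IsLocalization.injective _ (Submonoid.powers_le.2 hf)
  have hF := algebraMap_mem_nonZeroDivisors hf
  have hψ : Function.Injective (algebraMap (Rhat R f) (Rhatf R f)) :=
    IsLocalization.injective _ (Submonoid.powers_le.2 hF)
  have hu : IsUnit (algebraMap R (Rf R f) f) := IsLocalization.Away.algebraMap_isUnit f
  have hv : IsUnit (algebraMap (Rhat R f) (Rhatf R f) (algebraMap R (Rhat R f) f)) :=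
    IsLocalization.Away.algebraMap_isUnit _
  refine ⟨fun r s h => hφ (congrArg Prod.fst h), fun a b => ⟨fun h => ?_, ?_⟩, fun z => ?_⟩
  · obtain ⟨n, r, hr⟩ := IsLocalization.Away.surj f a
    have hb : algebraMap R (Rhat R f) r = algebraMap R (Rhat R f) f ^ n * b := by
      apply hψ
      rw [← psi_algebraMap, ← hr, map_mul, map_pow, psi_algebraMap, sub_eq_zero.1 h, map_mul,
        map_pow, mul_comm]
    obtain ⟨s, rfl⟩ := pow_dvd_of_algebraMap_eq_mul hb
    refine ⟨s, (hu.pow n).mul_right_cancel ?_, ?_⟩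
    · rw [hr, map_mul, map_pow, mul_comm]
    · rw [map_mul, map_pow] at hb
      exact ((mul_cancel_left_mem_nonZeroDivisors (pow_mem hF n)).1 hb).symm
  · rintro ⟨r, rfl, rfl⟩
    rw [psi_algebraMap, sub_self]
  · obtain ⟨n, x, hx⟩ := IsLocalization.Away.surj (algebraMap R (Rhat R f) f) z
    obtain ⟨r, y, rfl⟩ := exists_eq_algebraMap_add_pow_mul n x
    obtain ⟨a, ha⟩ := (hu.pow n).dvd (a := algebraMap R (Rf R f) r)
    refine ⟨(a, -y), (hv.pow n).mul_right_cancel ?_⟩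
    have ha' := congrArg (psi R f) ha
    simp only [map_mul, map_pow, psi_algebraMap] at ha'
    simp only [hx, map_neg, map_add, map_mul, map_pow]
    linear_combination -ha'
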